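/- Let n ≥ 4 be an integer and p a prime. The number of ordered pairs (C, C') with C, C' ∈ R^(n)(p) = R₀^(n)(p) ∪ R₁^(n)(p) such that the product C·C' belongs to the right coset Λ_n·diag(p, p, p², …, p², p³, p³) (with n−4 entries equal to p²) equals (p + 1)². -/

import Mathlib

open Matrix

/-- `Λ_n = GL_n(ℤ)` viewed inside the `n × n` rational matrices: the matrices with integer
entries whose determinant is `±1`. -/
def Lambda (n : ℕ) : Set (Matrix (Fin n) (Fin n) ℚ) :=
  {γ | (∀ i j, ∃ z : ℤ, γ i j = (z : ℚ)) ∧ (γ.det = 1 ∨ γ.det = -1)}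

/-- The right coset `Λ_n h = {γ * h : γ ∈ Λ_n}`. -/
def rightCoset (n : ℕ) (h : Matrix (Fin n) (Fin n) ℚ) : Set (Matrix (Fin n) (Fin n) ℚ) :=
  {m | ∃ γ ∈ Lambda n, m = γ * h}

/-- The double coset `Λ_n g Λ_n = {γ₁ * g * γ₂ : γ₁, γ₂ ∈ Λ_n}`. -/
def doubleCoset (n : ℕ) (g : Matrix (Fin n) (Fin n) ℚ) : Set (Matrix (Fin n) (Fin n) ℚ) :=
  {m | ∃ γ₁ ∈ Lambda n, ∃ γ₂ ∈ Lambda n, m = γ₁ * g * γ₂}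

/-- The degree of `g`: the number of distinct right cosets `Λ_n h` contained in `Λ_n g Λ_n`. -/
noncomputable def degree (n : ℕ) (g : Matrix (Fin n) (Fin n) ℚ) : ℕ :=
  Set.ncard {S : Set (Matrix (Fin n) (Fin n) ℚ) | ∃ h ∈ doubleCoset n g, S = rightCoset n h}

/-- The `k`-th determinantal divisor of an `n × n` integer matrix: the gcd of all of its
`k × k` minors (which is `0` when all these minors vanish), a minor being indexed by a pair
of strictly increasing maps `Fin k → Fin n` selecting rows and columns. -/
def detDiv (n k : ℕ) (C : Matrix (Fin n) (Fin n) ℤ) : ℤ :=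
  Finset.gcd ((Finset.univ : Finset ((Fin k → Fin n) × (Fin k → Fin n))).filter
      (fun fg => (∀ a b : Fin k, a < b → fg.1 a < fg.1 b) ∧
        (∀ a b : Fin k, a < b → fg.2 a < fg.2 b)))
    (fun fg => (C.submatrix fg.1 fg.2).det)

/-- `D^(n)(p) = diag(1, p, …, p, p²)` with `n - 2` middle diagonal entries equal to `p`. -/
def Dmat (n p : ℕ) : Matrix (Fin n) (Fin n) ℤ :=
  Matrix.diagonal (fun i => if i.val = 0 then 1 else if i.val = n - 1 then (p : ℤ) ^ 2 else (p : ℤ))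

/-- The set `R₀^(n)(p)` of upper-triangular integer matrices whose determinantal divisors are
`d_k = p^(k-1)` for `1 ≤ k ≤ n - 1` and `d_n = p^n`, whose diagonal entries all equal `p`, and
whose above-diagonal entries lie in `[0, p)`. -/
def R0 (n p : ℕ) : Set (Matrix (Fin n) (Fin n) ℤ) :=
  {C | (∀ i j : Fin n, j < i → C i j = 0) ∧
    (∀ k : ℕ, 1 ≤ k → k ≤ n - 1 → detDiv n k C = (p : ℤ) ^ (k - 1)) ∧
    detDiv n n C = (p : ℤ) ^ n ∧
    (∀ i : Fin n, C i i = (p : ℤ)) ∧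
    (∀ i j : Fin n, i < j → 0 ≤ C i j ∧ C i j < (p : ℤ))}

/-- The set `R₁^(n)(p)` of upper-triangular integer matrices whose diagonal entries lie in
`{1, p, p²}` with exactly one entry `1` and exactly one entry `p²`, whose above-diagonal
entries satisfy `0 ≤ c i j < c j j`, and such that `p ∣ c i i` implies `p ∣ c i j` for `j > i`. -/
def R1 (n p : ℕ) : Set (Matrix (Fin n) (Fin n) ℤ) :=
  {C | (∀ i j : Fin n, j < i → C i j = 0) ∧
    (∀ i : Fin n, C i i = 1 ∨ C i i = (p : ℤ) ∨ C i i = (p : ℤ) ^ 2) ∧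
    (∃! i : Fin n, C i i = 1) ∧
    (∃! i : Fin n, C i i = (p : ℤ) ^ 2) ∧
    (∀ i j : Fin n, i < j → 0 ≤ C i j ∧ C i j < C j j) ∧
    (∀ i j : Fin n, i < j → (p : ℤ) ∣ C i i → (p : ℤ) ∣ C i j)}

/-- Casting an integer matrix to a rational matrix. -/
def toQ (n : ℕ) (C : Matrix (Fin n) (Fin n) ℤ) : Matrix (Fin n) (Fin n) ℚ :=
  C.map (fun z : ℤ => (z : ℚ))

/-- The diagonal of `diag(p, p, p², …, p², p³, p³)`. -/
def targetDiag (n p : ℕ) (i : Fin n) : ℤ :=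
  if i.val ≤ 1 then (p : ℤ) else if n - 2 ≤ i.val then (p : ℤ) ^ 3 else (p : ℤ) ^ 2

/-- The diagonal of the left factor attached to the parameters `(a, b)`. -/
def leftDiag (n p a b : ℕ) (i : Fin n) : ℤ :=
  if i.val = 0 then (if a < p then (p : ℤ) else 1)
  else if i.val = 1 then (if a < p then 1 else (p : ℤ))
  else if i.val = n - 2 then (if b < p then (p : ℤ) ^ 2 else (p : ℤ))
  else if i.val = n - 1 then (if b < p then (p : ℤ) else (p : ℤ) ^ 2)
  else (p : ℤ)

/-- The diagonal of the right factor attached to the parameters `(a, b)`. -/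
def rightDiag (n p a b : ℕ) (i : Fin n) : ℤ :=
  if i.val = 0 then (if a < p then 1 else (p : ℤ))
  else if i.val = 1 then (if a < p then (p : ℤ) else 1)
  else if i.val = n - 2 then (if b < p then (p : ℤ) else (p : ℤ) ^ 2)
  else if i.val = n - 1 then (if b < p then (p : ℤ) ^ 2 else (p : ℤ))
  else (p : ℤ)

/-- The matrix with diagonal `d` whose only nonzero off-diagonal entries are `x` at the upper
corner of the first `2 × 2` block and `y` at that of the last `2 × 2` block. -/
def cornerMatrix (n : ℕ) (d : Fin n → ℤ) (x y : ℤ) : Matrix (Fin n) (Fin n) ℤ :=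
  fun i j => if i = j then d i else if i.val = 0 ∧ j.val = 1 then x
    else if i.val = n - 2 ∧ j.val = n - 1 then y else 0

/-- The pair of factors attached to the parameters `(a, b)`. -/
def factorPair (n p : ℕ) (ab : ℕ × ℕ) :
    Matrix (Fin n) (Fin n) ℤ × Matrix (Fin n) (Fin n) ℤ :=
  (Matrix.diagonal (leftDiag n p ab.1 ab.2),
    cornerMatrix n (rightDiag n p ab.1 ab.2) (if ab.1 < p then (ab.1 : ℤ) else 0)
      (if ab.2 < p then (p : ℤ) * ab.2 else 0))

theorem cornerMatrix_of_lt {n : ℕ} (hn : 4 ≤ n) (d : Fin n → ℤ) (x y : ℤ) {i j : Fin n}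
    (h : j < i) : cornerMatrix n d x y i j = 0 := by
  have h' : j.val < i.val := h
  unfold cornerMatrix
  rw [if_neg (ne_of_gt h), if_neg (by omega), if_neg (by omega)]

theorem leftDiag_mul_rightDiag {n : ℕ} (hn : 4 ≤ n) (p a b : ℕ) (i : Fin n) :
    leftDiag n p a b i * rightDiag n p a b i = targetDiag n p i := by
  have := i.isLt
  unfold leftDiag rightDiag targetDiag
  split_ifs <;> first | omega | ring

theorem diagonal_mem_R1 {n p a b : ℕ} (hn : 4 ≤ n) (hp : 2 ≤ p) :
    Matrix.diagonal (leftDiag n p a b) ∈ R1 n p := by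
  have hp' : (2 : ℤ) ≤ p := by exact_mod_cast hp
  have hpp : (p : ℤ) < (p : ℤ) ^ 2 := by nlinarith
  have hpos : ∀ i, 0 < leftDiag n p a b i := by
    intro i; unfold leftDiag; split_ifs <;> nlinarith
  refine ⟨fun i j h => Matrix.diagonal_apply_ne _ (ne_of_gt h), ?_, ?_, ?_, ?_, ?_⟩
  · intro i
    rw [Matrix.diagonal_apply_eq]
    unfold leftDiag
    split_ifs <;> simp
  · refine ⟨⟨if a < p then 1 else 0, by split_ifs <;> omega⟩, ?_, ?_⟩
    · simp only [Matrix.diagonal_apply_eq]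
      unfold leftDiag
      split_ifs <;> simp_all
    · intro i hi
      simp only [Matrix.diagonal_apply_eq] at hi
      unfold leftDiag at hi
      apply Fin.ext
      simp only
      split_ifs at hi ⊢ <;> omega
  · refine ⟨⟨if b < p then n - 2 else n - 1, by split_ifs <;> omega⟩, ?_, ?_⟩
    · simp only [Matrix.diagonal_apply_eq]
      unfold leftDiag
      simp only
      split_ifs <;> first | rfl | omega
    · intro i hi
      simp only [Matrix.diagonal_apply_eq] at hi
      unfold leftDiag at hi
      apply Fin.ext
      simp only
      split_ifs at hi ⊢ <;> omega
  · intro i j h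
    rw [Matrix.diagonal_apply_ne _ (ne_of_lt h), Matrix.diagonal_apply_eq]
    exact ⟨le_rfl, hpos j⟩
  · intro i j h _
    rw [Matrix.diagonal_apply_ne _ (ne_of_lt h)]
    exact dvd_zero _

theorem cornerMatrix_mem_R1 {n p a b : ℕ} (hn : 4 ≤ n) (hp : 2 ≤ p) :
    cornerMatrix n (rightDiag n p a b) (if a < p then (a : ℤ) else 0)
      (if b < p then (p : ℤ) * b else 0) ∈ R1 n p := by
  have hp' : (2 : ℤ) ≤ p := by exact_mod_cast hp
  have hpp : (p : ℤ) < (p : ℤ) ^ 2 := by nlinarith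
  have hdiag : ∀ d x y, ∀ i, cornerMatrix n d x y i i = d i := by
    intro d x y i; simp [cornerMatrix]
  have hpos : ∀ i, 0 < rightDiag n p a b i := by
    intro i; unfold rightDiag; split_ifs <;> nlinarith
  refine ⟨fun i j h => cornerMatrix_of_lt hn _ _ _ h, ?_, ?_, ?_, ?_, ?_⟩
  · intro i
    rw [hdiag]
    unfold rightDiag
    split_ifs <;> simp
  · refine ⟨⟨if a < p then 0 else 1, by split_ifs <;> omega⟩, ?_, ?_⟩
    · simp only [hdiag]
      unfold rightDiag
      split_ifs <;> simp_all
    · intro i hi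
      simp only [hdiag] at hi
      unfold rightDiag at hi
      apply Fin.ext
      simp only
      split_ifs at hi ⊢ <;> omega
  · refine ⟨⟨if b < p then n - 1 else n - 2, by split_ifs <;> omega⟩, ?_, ?_⟩
    · simp only [hdiag]
      unfold rightDiag
      simp only
      split_ifs <;> first | rfl | omega
    · intro i hi
      simp only [hdiag] at hi
      unfold rightDiag at hi
      apply Fin.ext
      simp only
      split_ifs at hi ⊢ <;> omega
  · intro i j h
    have hj := hpos j
    have hij : i.val < j.val := h
    rw [hdiag]
    unfold cornerMatrix
    rw [if_neg (ne_of_lt h)]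
    split_ifs with h1 ha h2 hb
    · have hd : rightDiag n p a b j = p := by simp [rightDiag, h1.2, ha]
      rw [hd]
      exact ⟨by positivity, by exact_mod_cast ha⟩
    · exact ⟨le_rfl, hj⟩
    · have hd : rightDiag n p a b j = (p : ℤ) ^ 2 := by
        unfold rightDiag
        rw [if_neg (by omega), if_neg (by omega), if_neg (by omega), if_pos h2.2, if_pos hb]
      have hb' : (b : ℤ) < p := by exact_mod_cast hb
      rw [hd]
      exact ⟨by positivity, by nlinarith⟩
    · exact ⟨le_rfl, hj⟩
    · exact ⟨le_rfl, hj⟩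
  · intro i j h hd
    rw [hdiag] at hd
    unfold cornerMatrix
    rw [if_neg (ne_of_lt h)]
    split_ifs with h1 ha h2 hb
    · have hd1 : rightDiag n p a b i = 1 := by simp [rightDiag, h1.1, ha]
      rw [hd1] at hd
      have := Int.le_of_dvd one_pos hd
      omega
    · exact dvd_zero _
    · exact dvd_mul_right _ _
    · exact dvd_zero _
    · exact dvd_zero _

theorem factorPair_mul {n p a b : ℕ} (hn : 4 ≤ n) :
    (factorPair n p (a, b)).1 * (factorPair n p (a, b)).2 =
      cornerMatrix n (fun _ => 1) (if a < p then (a : ℤ) else 0) (if b < p then (b : ℤ) else 0) *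
        Matrix.diagonal (targetDiag n p) := by
  ext i j
  rw [factorPair, Matrix.diagonal_mul, Matrix.mul_diagonal]
  simp only [cornerMatrix]
  by_cases hij : i = j
  · subst hij
    rw [if_pos rfl, if_pos rfl, leftDiag_mul_rightDiag hn, one_mul]
  rw [if_neg hij, if_neg hij]
  by_cases h1 : i.val = 0 ∧ j.val = 1
  · rw [if_pos h1, if_pos h1]
    by_cases ha : a < p
    · simp [leftDiag, targetDiag, h1.1, h1.2, ha, mul_comm]
    · simp [ha]
  rw [if_neg h1, if_neg h1]
  by_cases h2 : i.val = n - 2 ∧ j.val = n - 1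
  · rw [if_pos h2, if_pos h2]
    by_cases hb : b < p
    · have hl : leftDiag n p a b i = (p : ℤ) ^ 2 := by
        unfold leftDiag
        rw [if_neg (by omega), if_neg (by omega), if_pos h2.1, if_pos hb]
      have ht : targetDiag n p j = (p : ℤ) ^ 3 := by
        unfold targetDiag
        rw [if_neg (by omega), if_pos (by omega)]
      rw [if_pos hb, if_pos hb, hl, ht]
      ring
    · simp [hb]
  · simp [h2]

/-- Membership of an integer matrix in the right coset of an integer diagonal matrix. -/
theorem toQ_mem_rightCoset_iff {n p : ℕ} (N : Matrix (Fin n) (Fin n) ℤ) :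
    toQ n N ∈ rightCoset n (Matrix.diagonal fun i : Fin n =>
      if i.val ≤ 1 then (p : ℚ) else if n - 2 ≤ i.val then (p : ℚ) ^ 3 else (p : ℚ) ^ 2) ↔
    ∃ G : Matrix (Fin n) (Fin n) ℤ, (G.det = 1 ∨ G.det = -1) ∧
      N = G * Matrix.diagonal (targetDiag n p) := by
  have hD : (Matrix.diagonal fun i : Fin n =>
      if i.val ≤ 1 then (p : ℚ) else if n - 2 ≤ i.val then (p : ℚ) ^ 3 else (p : ℚ) ^ 2) =
      (Matrix.diagonal (targetDiag n p)).map (Int.castRingHom ℚ) := by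
    rw [Matrix.diagonal_map (map_zero _)]
    congr 1
    ext i
    simp only [targetDiag]
    split_ifs <;> simp
  have hQ : ∀ M : Matrix (Fin n) (Fin n) ℤ, toQ n M = M.map (Int.castRingHom ℚ) := fun _ => rfl
  have hdet : ∀ G : Matrix (Fin n) (Fin n) ℤ,
      (G.map (Int.castRingHom ℚ)).det = ((G.det : ℤ) : ℚ) := fun G =>
    ((Int.castRingHom ℚ).map_det G).symm
  have hinj : Function.Injective
      fun M : Matrix (Fin n) (Fin n) ℤ => M.map (Int.castRingHom ℚ) :=
    Matrix.map_injective Int.cast_injective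
  rw [hD, hQ]
  constructor
  · rintro ⟨γ, ⟨hentries, hdetγ⟩, hN⟩
    choose G hG using hentries
    have hγ : γ = Matrix.map (Matrix.of G) (Int.castRingHom ℚ) := by
      ext i j
      simp [hG]
    refine ⟨Matrix.of G, ?_, ?_⟩
    · rw [hγ, hdet] at hdetγ
      exact_mod_cast hdetγ
    · apply hinj
      simp only
      rw [hN, hγ, Matrix.map_mul]
  · rintro ⟨G, hG, rfl⟩
    refine ⟨G.map (Int.castRingHom ℚ), ⟨fun i j => ⟨G i j, rfl⟩, ?_⟩, Matrix.map_mul⟩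
    rw [hdet]
    exact_mod_cast hG

theorem det_cornerMatrix_one {n : ℕ} (hn : 4 ≤ n) (x y : ℤ) :
    (cornerMatrix n (fun _ => 1) x y).det = 1 := by
  rw [Matrix.det_of_isUpperTriangular]
  · simp [cornerMatrix]
  · intro i j h
    exact cornerMatrix_of_lt hn _ _ _ h

theorem targetDiag_pos {n p : ℕ} (hp : 0 < p) (i : Fin n) : 0 < targetDiag n p i := by
  unfold targetDiag
  split_ifs <;> positivity

theorem upperTriangular_mul_apply_self {n : ℕ} {C C' : Matrix (Fin n) (Fin n) ℤ}
    (hC : ∀ i j, j < i → C i j = 0) (hC' : ∀ i j, j < i → C' i j = 0) (i : Fin n) :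
    (C * C') i i = C i i * C' i i := by
  rw [Matrix.mul_apply]
  apply Fintype.sum_eq_single
  intro k hk
  rcases lt_or_gt_of_ne hk with h | h
  · rw [hC _ _ h, zero_mul]
  · rw [hC' _ _ h, mul_zero]

theorem upperTriangular_mul_apply_of_lt {n : ℕ} {C C' : Matrix (Fin n) (Fin n) ℤ}
    (hC : ∀ i j, j < i → C i j = 0) (hC' : ∀ i j, j < i → C' i j = 0) {i j : Fin n}
    (hij : j < i) : (C * C') i j = 0 := by
  rw [Matrix.mul_apply]
  apply Finset.sum_eq_zero
  intro k _
  rcases lt_or_ge k i with h | h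
  · rw [hC _ _ h, zero_mul]
  · rw [hC' _ _ (hij.trans_le h), mul_zero]

/-- A positive-diagonal upper triangular product lying in the right coset of the target has
exactly the diagonal of the target, and columns divisible by it. -/
theorem diag_eq_and_dvd_of_mul_eq {n : ℕ} {h : Fin n → ℤ} (hh : ∀ i, 0 < h i)
    {C C' G : Matrix (Fin n) (Fin n) ℤ}
    (hC : ∀ i j, j < i → C i j = 0) (hC' : ∀ i j, j < i → C' i j = 0)
    (hpos : ∀ i, 0 < C i i) (hpos' : ∀ i, 0 < C' i i)
    (hdet : G.det = 1 ∨ G.det = -1) (hG : C * C' = G * Matrix.diagonal h) :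
    (∀ i, C i i * C' i i = h i) ∧ ∀ i j, h j ∣ (C * C') i j := by
  have hent : ∀ i j, (C * C') i j = G i j * h j := by
    intro i j
    rw [hG, Matrix.mul_diagonal]
  refine ⟨fun i => ?_, fun i j => ⟨G i j, by rw [hent, mul_comm]⟩⟩
  have htri : G.BlockTriangular id := by
    intro a b hab
    have := hent a b
    have hab : b < a := hab
    rw [upperTriangular_mul_apply_of_lt hC hC' hab] at this
    exact (mul_eq_zero.mp this.symm).resolve_right (hh b).ne'
  have hunit : IsUnit G.det := by rcases hdet with h | h <;> simp [h]
  rw [Matrix.det_of_isUpperTriangular htri] at hunit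
  have hGi : IsUnit (G i i) := 
    isUnit_of_dvd_unit (Finset.dvd_prod_of_mem (fun k => G k k) (Finset.mem_univ i)) hunit
  have hi := hent i i
  rw [upperTriangular_mul_apply_self hC hC'] at hi
  have hprod : 0 < G i i * h i := hi ▸ mul_pos (hpos i) (hpos' i)
  rcases Int.isUnit_iff.mp hGi with h1 | h1
  · rw [hi, h1, one_mul]
  · rw [h1] at hprod
    have := hh i
    linarith

theorem eq_zero_of_add_mul_dvd {u w x y : ℤ} (hu : 0 ≤ u) (hux : u < x) (hw : 0 ≤ w)
    (hwy : w < y) (h : x * y ∣ w + u * y) : u = 0 ∧ w = 0 := by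
  have hw0 : w = 0 := by
    have : y ∣ w := (dvd_add_left (dvd_mul_left y u)).mp ((dvd_mul_left y x).trans h)
    exact Int.eq_zero_of_dvd_of_nonneg_of_lt hw hwy this
  subst hw0
  rw [zero_add] at h
  exact ⟨Int.eq_zero_of_dvd_of_nonneg_of_lt hu hux
    (Int.dvd_of_mul_dvd_mul_right (by omega) h), rfl⟩

theorem eq_zero_of_mul_add_mul_dvd {u w q y : ℤ} (hq : 0 < q) (hu : 0 ≤ u) (huq : u < q)
    (hqu : q ∣ u) (hw : 0 ≤ w) (hwy : w < y) (h : q * y ∣ q * w + u * y) :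
    u = 0 ∧ w = 0 := by
  have hu0 : u = 0 := Int.eq_zero_of_dvd_of_nonneg_of_lt hu huq hqu
  subst hu0
  rw [zero_mul, add_zero] at h
  exact ⟨rfl, Int.eq_zero_of_dvd_of_nonneg_of_lt hw hwy
    (Int.dvd_of_mul_dvd_mul_left hq.ne' h)⟩

theorem eq_zero_of_sq_mul_dvd {u w q : ℤ} (hq : 0 < q) (hu : 0 ≤ u) (huq : u < q ^ 2)
    (hqu : q ∣ u) (hw : 0 ≤ w) (hwq : w < q) (h : q ^ 2 * q ∣ q * w + u * q) :
    u = 0 ∧ w = 0 := by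
  have h1 : q ^ 2 ∣ w + u := by
    apply Int.dvd_of_mul_dvd_mul_right hq.ne'
    convert h using 1
    ring
  have hw0 : w = 0 := by
    have : q ∣ w := (dvd_add_left hqu).mp ((dvd_pow_self q two_ne_zero).trans h1)
    exact Int.eq_zero_of_dvd_of_nonneg_of_lt hw hwq this
  subst hw0
  rw [zero_add] at h1
  exact ⟨Int.eq_zero_of_dvd_of_nonneg_of_lt hu huq h1, rfl⟩

/-- The possible shapes of the diagonals of two factors whose product has the target diagonal. -/
def IsDiagProfile (n p : ℕ) (d d' : Fin n → ℤ) : Prop :=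
  ∀ i : Fin n,
    (i.val ≤ 1 ∧ (d i = 1 ∧ d' i = p ∨ d i = p ∧ d' i = 1)) ∨
    (2 ≤ i.val ∧ i.val < n - 2 ∧ d i = p ∧ d' i = p) ∨
    (n - 2 ≤ i.val ∧ (d i = p ∧ d' i = (p : ℤ) ^ 2 ∨ d i = (p : ℤ) ^ 2 ∧ d' i = p))

theorem R1_of_diag_one {n p : ℕ} (hp : 2 ≤ p) {C : Matrix (Fin n) (Fin n) ℤ}
    (hC : C ∈ R0 n p ∪ R1 n p) {i : Fin n} (hi : C i i = 1) : C ∈ R1 n p := by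
  rcases hC with h | h
  · have := h.2.2.2.1 i
    omega
  · exact h

theorem diag_mem_of_mem {n p : ℕ} {C : Matrix (Fin n) (Fin n) ℤ}
    (hC : C ∈ R0 n p ∪ R1 n p) (i : Fin n) :
    C i i = 1 ∨ C i i = (p : ℤ) ∨ C i i = (p : ℤ) ^ 2 := by
  rcases hC with h | h
  · exact Or.inr (Or.inl (h.2.2.2.1 i))
  · exact h.2.1 i

theorem upperTriangular_of_mem {n p : ℕ} {C : Matrix (Fin n) (Fin n) ℤ}
    (hC : C ∈ R0 n p ∪ R1 n p) (i j : Fin n) (h : j < i) : C i j = 0 := by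
  rcases hC with hC | hC
  · exact hC.1 i j h
  · exact hC.1 i j h

theorem mul_eq_self_cases {q x y : ℤ} (hq : 2 ≤ q) (hx : x = 1 ∨ x = q ∨ x = q ^ 2)
    (hy : y = 1 ∨ y = q ∨ y = q ^ 2) (h : x * y = q) : x = 1 ∧ y = q ∨ x = q ∧ y = 1 := by
  rcases hx with rfl | rfl | rfl
  · left; exact ⟨rfl, by linarith⟩
  · right; exact ⟨rfl, by nlinarith⟩
  · exfalso
    have h1 : q * y = 1 := mul_left_cancel₀ (by omega : q ≠ 0) (by linarith)
    have := Int.le_of_dvd one_pos (Dvd.intro y h1)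
    omega

theorem mul_eq_sq_cases {q x y : ℤ} (hq : 2 ≤ q) (hx : x = 1 ∨ x = q ∨ x = q ^ 2)
    (hy : y = 1 ∨ y = q ∨ y = q ^ 2) (hx1 : x ≠ 1) (hy1 : y ≠ 1) (h : x * y = q ^ 2) :
    x = q ∧ y = q := by
  rcases hx with rfl | rfl | rfl
  · exact absurd rfl hx1
  · exact ⟨rfl, by nlinarith⟩
  · have : y = 1 := mul_left_cancel₀ (pow_ne_zero 2 (by omega : q ≠ 0)) (by linarith)
    exact absurd this hy1

theorem mul_eq_cube_cases {q x y : ℤ} (hq : 2 ≤ q) (hx : x = 1 ∨ x = q ∨ x = q ^ 2)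
    (hy : y = 1 ∨ y = q ∨ y = q ^ 2) (h : x * y = q ^ 3) :
    x = q ∧ y = q ^ 2 ∨ x = q ^ 2 ∧ y = q := by
  have hq2 : 0 < q ^ 2 := by positivity
  rcases hx with rfl | rfl | rfl
  · exfalso
    rcases hy with rfl | rfl | rfl <;> nlinarith
  · left
    exact ⟨rfl, mul_left_cancel₀ (by omega : x ≠ 0) (by linarith)⟩
  · right
    exact ⟨rfl, mul_left_cancel₀ hq2.ne' (by linarith)⟩

theorem mem_R1_and_isDiagProfile {n p : ℕ} (hn : 4 ≤ n) (hp : 2 ≤ p)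
    {C C' : Matrix (Fin n) (Fin n) ℤ}
    (hC : C ∈ R0 n p ∪ R1 n p) (hC' : C' ∈ R0 n p ∪ R1 n p)
    (hdiag : ∀ i, C i i * C' i i = targetDiag n p i) :
    C ∈ R1 n p ∧ C' ∈ R1 n p ∧ IsDiagProfile n p (fun i => C i i) (fun i => C' i i) := by
  have hq : (2 : ℤ) ≤ p := by exact_mod_cast hp
  have hhead : ∀ i : Fin n, i.val ≤ 1 →
      C i i = 1 ∧ C' i i = p ∨ C i i = p ∧ C' i i = 1 := by
    intro i hi
    refine mul_eq_self_cases hq (diag_mem_of_mem hC i) (diag_mem_of_mem hC' i) ?_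
    rw [hdiag, targetDiag, if_pos hi]
  have hne : (⟨0, by omega⟩ : Fin n) ≠ ⟨1, by omega⟩ := by simp
  have hmem : (∃ i : Fin n, i.val ≤ 1 ∧ C i i = 1) ∧ ∃ i : Fin n, i.val ≤ 1 ∧ C' i i = 1 := by
    rcases hhead ⟨0, by omega⟩ (by simp) with ⟨h, -⟩ | ⟨-, h⟩
    · refine ⟨⟨_, by simp, h⟩, ?_⟩
      rcases hhead ⟨1, by omega⟩ (by simp) with ⟨h', -⟩ | ⟨-, h'⟩
      · exact absurd ((R1_of_diag_one hp hC h).2.2.1.unique h h') hne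
      · exact ⟨_, by simp, h'⟩
    · refine ⟨?_, ⟨_, by simp, h⟩⟩
      rcases hhead ⟨1, by omega⟩ (by simp) with ⟨h', -⟩ | ⟨-, h'⟩
      · exact ⟨_, by simp, h'⟩
      · exact absurd ((R1_of_diag_one hp hC' h).2.2.1.unique h h') hne
  obtain ⟨⟨r, hr, hCr⟩, ⟨r', hr', hCr'⟩⟩ := hmem
  have hR := R1_of_diag_one hp hC hCr
  have hR' := R1_of_diag_one hp hC' hCr'
  refine ⟨hR, hR', fun i => ?_⟩
  have hi := hdiag i
  unfold targetDiag at hi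
  by_cases h1 : i.val ≤ 1
  · exact Or.inl ⟨h1, hhead i h1⟩
  rw [if_neg h1] at hi
  by_cases h2 : n - 2 ≤ i.val
  · rw [if_pos h2] at hi
    exact Or.inr (Or.inr ⟨h2, mul_eq_cube_cases hq (hR.2.1 i) (hR'.2.1 i) hi⟩)
  · rw [if_neg h2] at hi
    refine Or.inr (Or.inl ⟨by omega, by omega, mul_eq_sq_cases hq (hR.2.1 i) (hR'.2.1 i) ?_ ?_ hi⟩)
    · intro h
      have := hR.2.2.1.unique h hCr
      subst this
      exact h1 hr
    · intro h
      have := hR'.2.2.1.unique h hCr'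
      subst this
      exact h1 hr'

/-- Off the diagonal the left factor vanishes, and the right factor vanishes outside the two
corner entries. -/
theorem offDiag_eq_zero {n p : ℕ} (hn : 4 ≤ n) (hp : 2 ≤ p)
    {C C' : Matrix (Fin n) (Fin n) ℤ} (hC : C ∈ R1 n p) (hC' : C' ∈ R1 n p)
    (hprof : IsDiagProfile n p (fun i => C i i) (fun i => C' i i))
    (hdiag : ∀ i, C i i * C' i i = targetDiag n p i)
    (hdvd : ∀ i j, targetDiag n p j ∣ (C * C') i j) (i j : Fin n) (hij : i < j) :
    C i j = 0 ∧ (C' i j = 0 ∨ (i.val = 0 ∧ j.val = 1 ∧ C' i i = 1) ∨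
      (i.val = n - 2 ∧ j.val = n - 1 ∧ C' i i = p)) := by
  have hq : (2 : ℤ) ≤ p := by exact_mod_cast hp
  have hpp : (p : ℤ) < (p : ℤ) ^ 2 := by nlinarith
  induction hm : j.val - i.val using Nat.strong_induction_on generalizing i j with
  | _ m ih =>
  have hij' : i.val < j.val := hij
  have hjn := j.isLt
  have hprod : (C * C') i j = C i i * C' i j + C i j * C' j j := by
    rw [Matrix.mul_apply]
    apply Fintype.sum_eq_add i j hij.ne
    rintro k ⟨hki, hkj⟩
    rcases lt_or_gt_of_ne hki with h | h
    · rw [hC.1 _ _ h, zero_mul]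
    rcases lt_or_gt_of_ne hkj with h' | h'
    · have h1 : i.val < k.val := h
      have h2 : k.val < j.val := h'
      rw [(ih _ (by omega) i k h rfl).1, zero_mul]
    · rw [hC'.1 _ _ h', mul_zero]
  have hd := hdvd i j
  rw [hprod, ← hdiag j] at hd
  obtain ⟨hu, hu'⟩ := hC.2.2.2.2.1 i j hij
  obtain ⟨hw, hw'⟩ := hC'.2.2.2.2.1 i j hij
  have hpu := hC.2.2.2.2.2 i j hij
  have hPi := hprof i
  have hPj := hprof j
  simp only at hPi hPj
  rcases hC.2.1 i with hci | hci | hci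
  · rw [hci, one_mul] at hd
    obtain ⟨h1, h2⟩ := eq_zero_of_add_mul_dvd hu hu' hw hw' hd
    exact ⟨h1, Or.inl h2⟩
  · rw [hci] at hd hpu
    have hpu := hpu dvd_rfl
    rcases hC.2.1 j with hcj | hcj | hcj
    · rw [hcj] at hu'
      refine ⟨by omega, Or.inr (Or.inl ?_)⟩
      rcases hPj with ⟨hj, -⟩ | ⟨-, -, hj, -⟩ | ⟨-, ⟨hj, -⟩ | ⟨hj, -⟩⟩
      · refine ⟨by omega, by omega, ?_⟩
        rcases hPi with ⟨-, ⟨h, -⟩ | ⟨-, h⟩⟩ | ⟨h, -⟩ | ⟨h, -⟩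
        · omega
        · exact h
        · omega
        · omega
      all_goals exfalso; linarith
    · rw [hcj] at hd hu'
      obtain ⟨h1, h2⟩ := eq_zero_of_mul_add_mul_dvd (by omega) hu hu' hpu hw hw' hd
      exact ⟨h1, Or.inl h2⟩
    · have hcj' : C' j j = p := by
        rcases hPj with ⟨-, ⟨hj, -⟩ | ⟨hj, -⟩⟩ | ⟨-, -, hj, -⟩ | ⟨-, ⟨hj, -⟩ | ⟨-, hj⟩⟩
        · linarith
        · linarith
        · linarith
        · linarith
        · exact hj
      rw [hcj, hcj'] at hd
      rw [hcj] at hu'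
      rw [hcj'] at hw'
      obtain ⟨h1, h2⟩ := eq_zero_of_sq_mul_dvd (by omega) hu hu' hpu hw hw' hd
      exact ⟨h1, Or.inl h2⟩
  · rw [hci] at hpu
    have hpu := hpu (dvd_pow_self _ two_ne_zero)
    have hi : n - 2 ≤ i.val ∧ C' i i = p := by
      rcases hPi with ⟨-, ⟨h, -⟩ | ⟨h, -⟩⟩ | ⟨-, -, h, -⟩ | ⟨hi, ⟨h, -⟩ | ⟨-, h⟩⟩
      · linarith
      · linarith
      · linarith
      · linarith
      · exact ⟨hi, h⟩
    have hcj : C j j = p := by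
      rcases hPj with ⟨h, -⟩ | ⟨-, h, -⟩ | ⟨-, ⟨h, -⟩ | ⟨h, -⟩⟩
      · omega
      · omega
      · exact h
      · exact absurd (hC.2.2.2.1.unique hci h) hij.ne
    rw [hcj] at hu'
    exact ⟨Int.eq_zero_of_dvd_of_nonneg_of_lt hu hu' hpu,
      Or.inr (Or.inr ⟨by omega, by omega, hi.2⟩)⟩

theorem exists_factorPair_eq {n p : ℕ} (hn : 4 ≤ n) (hp : 2 ≤ p)
    {C C' : Matrix (Fin n) (Fin n) ℤ} (hC : C ∈ R1 n p) (hC' : C' ∈ R1 n p)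
    (hprof : IsDiagProfile n p (fun i => C i i) (fun i => C' i i))
    (hoff : ∀ i j, i < j → C i j = 0 ∧ (C' i j = 0 ∨ (i.val = 0 ∧ j.val = 1 ∧ C' i i = 1) ∨
      (i.val = n - 2 ∧ j.val = n - 1 ∧ C' i i = p))) :
    ∃ a ≤ p, ∃ b ≤ p, factorPair n p (a, b) = (C, C') := by
  have hq : (2 : ℤ) ≤ p := by exact_mod_cast hp
  have hpp : (p : ℤ) < (p : ℤ) ^ 2 := by nlinarith
  obtain ⟨i0, hi0⟩ : ∃ i : Fin n, i.val = 0 := ⟨⟨0, by omega⟩, rfl⟩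
  obtain ⟨i1, hi1⟩ : ∃ i : Fin n, i.val = 1 := ⟨⟨1, by omega⟩, rfl⟩
  obtain ⟨j0, hj0⟩ : ∃ i : Fin n, i.val = n - 2 := ⟨⟨n - 2, by omega⟩, rfl⟩
  obtain ⟨j1, hj1⟩ : ∃ i : Fin n, i.val = n - 1 := ⟨⟨n - 1, by omega⟩, rfl⟩
  have hi01 : i0 < i1 := by rw [Fin.lt_def]; omega
  have hj01 : j0 < j1 := by rw [Fin.lt_def]; omega
  have hhead : (C i0 i0 = p ∧ C' i0 i0 = 1 ∧ C i1 i1 = 1 ∧ C' i1 i1 = p) ∨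
      (C i0 i0 = 1 ∧ C' i0 i0 = p ∧ C i1 i1 = p ∧ C' i1 i1 = 1) := by
    have h0 := ((hprof i0).resolve_right (by omega)).2
    have h1 := ((hprof i1).resolve_right (by omega)).2
    have hu : ¬ (C i0 i0 = 1 ∧ C i1 i1 = 1) := fun h => hi01.ne (hC.2.2.1.unique h.1 h.2)
    have hu' : ¬ (C' i0 i0 = 1 ∧ C' i1 i1 = 1) := fun h => hi01.ne (hC'.2.2.1.unique h.1 h.2)
    tauto
  have htail : (C j0 j0 = (p : ℤ) ^ 2 ∧ C' j0 j0 = p ∧ C j1 j1 = p ∧ C' j1 j1 = (p : ℤ) ^ 2) ∨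
      (C j0 j0 = p ∧ C' j0 j0 = (p : ℤ) ^ 2 ∧ C j1 j1 = (p : ℤ) ^ 2 ∧ C' j1 j1 = p) := by
    have h0 := (((hprof j0).resolve_left (by omega)).resolve_left (by omega)).2
    have h1 := (((hprof j1).resolve_left (by omega)).resolve_left (by omega)).2
    have hu : ¬ (C j0 j0 = (p : ℤ) ^ 2 ∧ C j1 j1 = (p : ℤ) ^ 2) :=
      fun h => hj01.ne (hC.2.2.2.1.unique h.1 h.2)
    have hu' : ¬ (C' j0 j0 = (p : ℤ) ^ 2 ∧ C' j1 j1 = (p : ℤ) ^ 2) :=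
      fun h => hj01.ne (hC'.2.2.2.1.unique h.1 h.2)
    tauto
  have hmid : ∀ i : Fin n, i ≠ i0 → i ≠ i1 → i ≠ j0 → i ≠ j1 → C i i = p ∧ C' i i = p := by
    intro i h0 h1 h2 h3
    have := i.isLt
    rw [ne_eq, Fin.ext_iff] at h0 h1 h2 h3
    exact (((hprof i).resolve_left (by omega)).resolve_right (by omega)).2.2
  obtain ⟨a, hap, ha⟩ : ∃ a ≤ p, (a < p ∧ C' i0 i0 = 1 ∧ C' i0 i1 = a) ∨
      (¬ a < p ∧ C' i0 i0 = p ∧ C' i0 i1 = 0) := by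
    obtain ⟨hx, hx'⟩ := hC'.2.2.2.2.1 i0 i1 hi01
    rcases hhead with ⟨-, h, -, h'⟩ | ⟨-, h, -, h'⟩
    · exact ⟨(C' i0 i1).toNat, by omega, Or.inl ⟨by omega, h, by omega⟩⟩
    · exact ⟨p, le_rfl, Or.inr ⟨lt_irrefl _, h, by omega⟩⟩
  obtain ⟨b, hbp, hb⟩ : ∃ b ≤ p, (b < p ∧ C' j0 j0 = p ∧ C' j0 j1 = p * b) ∨
      (¬ b < p ∧ C' j0 j0 = (p : ℤ) ^ 2 ∧ C' j0 j1 = 0) := by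
    obtain ⟨hx, hx'⟩ := hC'.2.2.2.2.1 j0 j1 hj01
    have hdvd := hC'.2.2.2.2.2 j0 j1 hj01
    rcases htail with ⟨-, h, -, h'⟩ | ⟨-, h, -, h'⟩
    · rw [h] at hdvd
      obtain ⟨c, hc⟩ := hdvd dvd_rfl
      rw [hc] at hx hx'
      rw [h'] at hx'
      have hc0 : 0 ≤ c := nonneg_of_mul_nonneg_right hx (by omega)
      have hcp : c < p := by nlinarith
      exact ⟨c.toNat, by omega, Or.inl ⟨by omega, h, by rw [hc, Int.toNat_of_nonneg hc0]⟩⟩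
    · rw [h] at hdvd
      have hd := hdvd (dvd_pow_self _ two_ne_zero)
      rw [h'] at hx'
      exact ⟨p, le_rfl, Or.inr ⟨lt_irrefl _, h,
        Int.eq_zero_of_dvd_of_nonneg_of_lt hx hx' hd⟩⟩
  have hdiags : ∀ i, C i i = leftDiag n p a b i ∧ C' i i = rightDiag n p a b i := by
    intro i
    unfold leftDiag rightDiag
    by_cases h0 : i = i0
    · subst h0
      simp only [hi0, if_true]
      split_ifs <;> omega
    by_cases h1 : i = i1
    · subst h1
      simp only [hi1, one_ne_zero, if_true, if_false]
      split_ifs <;> omega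
    have e0 : i.val ≠ 0 := fun h => h0 (Fin.ext (h.trans hi0.symm))
    have e1 : i.val ≠ 1 := fun h => h1 (Fin.ext (h.trans hi1.symm))
    simp only [e0, e1, if_false]
    by_cases h2 : i = j0
    · subst h2
      simp only [hj0, if_true]
      split_ifs <;> omega
    have e2 : i.val ≠ n - 2 := fun h => h2 (Fin.ext (h.trans hj0.symm))
    simp only [e2, if_false]
    by_cases h3 : i = j1
    · subst h3
      simp only [hj1, if_true]
      split_ifs <;> omega
    have e3 : i.val ≠ n - 1 := fun h => h3 (Fin.ext (h.trans hj1.symm))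
    simp only [e3, if_false]
    exact hmid i h0 h1 h2 h3
  refine ⟨a, hap, b, hbp, Prod.ext ?_ ?_⟩
  · ext i j
    simp only [factorPair]
    rcases lt_trichotomy i j with h | rfl | h
    · rw [Matrix.diagonal_apply_ne _ h.ne, (hoff i j h).1]
    · rw [Matrix.diagonal_apply_eq, (hdiags i).1]
    · rw [Matrix.diagonal_apply_ne _ h.ne', hC.1 i j h]
  · ext i j
    simp only [factorPair]
    rcases lt_trichotomy i j with h | rfl | h
    · unfold cornerMatrix
      rw [if_neg h.ne]
      by_cases h1 : i.val = 0 ∧ j.val = 1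
      · obtain rfl : i = i0 := Fin.ext (by omega)
        obtain rfl : j = i1 := Fin.ext (by omega)
        rw [if_pos h1]
        split_ifs <;> omega
      rw [if_neg h1]
      by_cases h2 : i.val = n - 2 ∧ j.val = n - 1
      · obtain rfl : i = j0 := Fin.ext (by omega)
        obtain rfl : j = j1 := Fin.ext (by omega)
        rw [if_pos h2]
        split_ifs with hbp'
        · exact (hb.resolve_right fun h => h.1 hbp').2.2.symm
        · exact (hb.resolve_left fun h => hbp' h.1).2.2.symm
      rw [if_neg h2]
      have := (hoff i j h).2
      omega
    · simp [cornerMatrix, (hdiags i).2]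
    · rw [cornerMatrix_of_lt hn _ _ _ h, hC'.1 i j h]

theorem factorPair_injOn {n p : ℕ} (hn : 4 ≤ n) (hp : 2 ≤ p) :
    Set.InjOn (factorPair n p) {ab | ab.1 ≤ p ∧ ab.2 ≤ p} := by
  have hq : (2 : ℤ) ≤ p := by exact_mod_cast hp
  have hpp : (p : ℤ) < (p : ℤ) ^ 2 := by nlinarith
  rintro ⟨a, b⟩ ⟨ha, hb⟩ ⟨a', b'⟩ ⟨ha', hb'⟩ h
  have h2 := (Prod.ext_iff.mp h).2
  simp only [factorPair] at ha hb ha' hb' h2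
  have h00 := congrFun (congrFun h2 ⟨0, by omega⟩) ⟨0, by omega⟩
  have h01 := congrFun (congrFun h2 ⟨0, by omega⟩) ⟨1, by omega⟩
  have hnn := congrFun (congrFun h2 ⟨n - 2, by omega⟩) ⟨n - 2, by omega⟩
  have hnn' := congrFun (congrFun h2 ⟨n - 2, by omega⟩) ⟨n - 1, by omega⟩
  have e1 : n - 2 ≠ 0 := by omega
  have e2 : n - 2 ≠ 1 := by omega
  have e3 : n - 2 ≠ n - 1 := by omega
  simp only [cornerMatrix, rightDiag, Fin.mk.injEq, if_true, if_false, zero_ne_one, and_self,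
    e1, e2, e3, false_and] at h00 h01 hnn hnn'
  have hab : a = a' := by
    split_ifs at h00 h01 <;> omega
  have hbb : b = b' := by
    split_ifs at hnn hnn'
    · exact_mod_cast mul_left_cancel₀ (by omega : (p : ℤ) ≠ 0) hnn'
    all_goals omega
  rw [hab, hbb]

theorem statement19 (n p : ℕ) (hn : 4 ≤ n) (hp : p.Prime) :
    {CC : Matrix (Fin n) (Fin n) ℤ × Matrix (Fin n) (Fin n) ℤ |
        CC.1 ∈ R0 n p ∪ R1 n p ∧ CC.2 ∈ R0 n p ∪ R1 n p ∧
        toQ n (CC.1 * CC.2) ∈ rightCoset n (Matrix.diagonal fun i : Fin n =>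
      if i.val ≤ 1 then (p : ℚ) else if n - 2 ≤ i.val then (p : ℚ) ^ 3 else (p : ℚ) ^ 2)}.ncard =
      (p + 1) ^ 2 := by
  have hp2 := hp.two_le
  have hset : {CC : Matrix (Fin n) (Fin n) ℤ × Matrix (Fin n) (Fin n) ℤ |
        CC.1 ∈ R0 n p ∪ R1 n p ∧ CC.2 ∈ R0 n p ∪ R1 n p ∧
        toQ n (CC.1 * CC.2) ∈ rightCoset n (Matrix.diagonal fun i : Fin n =>
      if i.val ≤ 1 then (p : ℚ) else if n - 2 ≤ i.val then (p : ℚ) ^ 3 else (p : ℚ) ^ 2)} =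
      factorPair n p '' ↑(Finset.range (p + 1) ×ˢ Finset.range (p + 1)) := by
    ext ⟨C, C'⟩
    simp only [Set.mem_ofPred_eq, toQ_mem_rightCoset_iff, Set.mem_image, Finset.mem_coe,
      Finset.mem_product, Finset.mem_range, Prod.exists]
    constructor
    · rintro ⟨hC, hC', G, hdet, hG⟩
      have hpos : ∀ {M : Matrix (Fin n) (Fin n) ℤ}, M ∈ R0 n p ∪ R1 n p → ∀ i, 0 < M i i := by
        intro M hM i
        have : (0 : ℤ) < p := by exact_mod_cast hp.pos
        rcases diag_mem_of_mem hM i with h | h | h <;> rw [h] <;> positivity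
      obtain ⟨hdiag, hdvd⟩ := diag_eq_and_dvd_of_mul_eq (targetDiag_pos hp.pos)
        (upperTriangular_of_mem hC) (upperTriangular_of_mem hC') (hpos hC) (hpos hC') hdet hG
      obtain ⟨hR, hR', hprof⟩ := mem_R1_and_isDiagProfile hn hp2 hC hC' hdiag
      obtain ⟨a, ha, b, hb, hab⟩ := exists_factorPair_eq hn hp2 hR hR' hprof
        (offDiag_eq_zero hn hp2 hR hR' hprof hdiag hdvd)
      exact ⟨a, b, ⟨by omega, by omega⟩, hab⟩
    · rintro ⟨a, b, -, hab⟩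
      have h1 : (factorPair n p (a, b)).1 = C := by rw [hab]
      have h2 : (factorPair n p (a, b)).2 = C' := by rw [hab]
      rw [← h1, ← h2]
      exact ⟨Or.inr (diagonal_mem_R1 hn hp2), Or.inr (cornerMatrix_mem_R1 hn hp2), _,
        Or.inl (det_cornerMatrix_one hn _ _), factorPair_mul hn⟩
  rw [hset, Set.InjOn.ncard_image, Set.ncard_coe_finset, Finset.card_product,
    Finset.card_range, sq]
  refine (factorPair_injOn hn hp2).mono ?_
  rintro ⟨a, b⟩ h
  simp only [Finset.mem_coe, Finset.mem_product, Finset.mem_range] at h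
  exact ⟨by simp only; omega, by simp only; omega⟩
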